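/- (Theorem 2.2 (i): Aubin–Lions type compactness) Let α > 0, δ > 0, β ∈ (0,1], s < t, and let (u_m)_{m∈ℕ} be a sequence of functions u_m : [s,t] → V_α, each strongly measurable, such that sup_m ∫_s^t ‖u_m(r)‖_{V_α}² dr < ∞ and sup_m ( sup_{r∈[s,t]} ‖u_m(r)‖_{V_{−δ}} + |||u_m|||_{β,[s,t],V_{−δ}} ) < ∞. Then there exist a subsequence (u_{m_j}) and a function u ∈ L²(s,t;V) ∩ C([s,t];V_{−δ}) such that ∫_s^t ‖u_{m_j}(r) − u(r)‖_V² dr → 0 and sup_{r∈[s,t]} ‖u_{m_j}(r) − u(r)‖_{V_{−δ}} → 0 as j → ∞. -/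

import Mathlib

open Set Filter MeasureTheory

/-- The wavenumbers `k_n = k₀ λ^n`. -/
noncomputable def kk (k0 lam : ℝ) (n : ℕ) : ℝ := k0 * lam ^ n

/-- Membership in the space `V_α`. -/
def memV (k0 lam α : ℝ) (u : ℕ → ℂ) : Prop :=
  Summable (fun n : ℕ => (kk k0 lam (n+1)) ^ (4*α) * ‖u (n+1)‖^2)

/-- The `V_α`-norm. -/
noncomputable def normV (k0 lam α : ℝ) (u : ℕ → ℂ) : ℝ :=
  Real.sqrt (∑' n : ℕ, (kk k0 lam (n+1)) ^ (4*α) * ‖u (n+1)‖^2)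

open scoped ENNReal NNReal Topology

/-- The weighted square sum `∑ c_n |v_n|²`, with values in `[0, ∞]`. -/
noncomputable def weightedSq (c : ℕ → ℝ≥0) (v : ℕ → ℂ) : ℝ≥0∞ :=
  ∑' n, (c n : ℝ≥0∞) * ‖v n‖ₑ ^ 2

section weightedSq

variable {a b c d : ℕ → ℝ≥0}

theorem le_weightedSq (c : ℕ → ℝ≥0) (v : ℕ → ℂ) (n : ℕ) :
    (c n : ℝ≥0∞) * ‖v n‖ₑ ^ 2 ≤ weightedSq c v :=
  ENNReal.le_tsum n

theorem weightedSq_sub_comm (c : ℕ → ℝ≥0) (x y : ℕ → ℂ) :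
    weightedSq c (x - y) = weightedSq c (y - x) := by
  unfold weightedSq
  refine tsum_congr fun n => ?_
  rw [Pi.sub_apply, Pi.sub_apply, ← enorm_neg, neg_sub]

theorem weightedSq_zero (c : ℕ → ℝ≥0) : weightedSq c 0 = 0 := by
  simp [weightedSq]

theorem weightedSq_neg (c : ℕ → ℝ≥0) (x : ℕ → ℂ) : weightedSq c (-x) = weightedSq c x := by
  simp [weightedSq]

theorem weightedSq_mono (h : c ≤ d) (v : ℕ → ℂ) : weightedSq c v ≤ weightedSq d v := by
  unfold weightedSq
  gcongr
  exact h _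

theorem weightedSq_add_le (c : ℕ → ℝ≥0) (x y : ℕ → ℂ) :
    weightedSq c (x + y) ≤ 2 * (weightedSq c x + weightedSq c y) := by
  unfold weightedSq
  rw [← ENNReal.tsum_add, ← ENNReal.tsum_mul_left]
  refine ENNReal.tsum_le_tsum fun n => ?_
  have h : ‖x n + y n‖₊ ^ 2 ≤ 2 * (‖x n‖₊ ^ 2 + ‖y n‖₊ ^ 2) :=
    (pow_le_pow_left' (nnnorm_add_le _ _) 2).trans add_sq_le
  have h' : ‖(x + y) n‖ₑ ^ 2 ≤ 2 * (‖x n‖ₑ ^ 2 + ‖y n‖ₑ ^ 2) := by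
    simp only [enorm_eq_nnnorm, Pi.add_apply]
    exact_mod_cast h
  rw [← mul_add, mul_left_comm]
  exact mul_le_mul_right h' _

theorem weightedSq_sub_le (c : ℕ → ℝ≥0) (x y : ℕ → ℂ) :
    weightedSq c (x - y) ≤ 2 * (weightedSq c x + weightedSq c y) := by
  rw [sub_eq_add_neg, ← weightedSq_neg c y]
  exact weightedSq_add_le c x (-y)

theorem weightedSq_sub_le_three (c : ℕ → ℝ≥0) (x y z w : ℕ → ℂ) :
    weightedSq c (x - w) ≤
      4 * (weightedSq c (x - y) + weightedSq c (y - z) + weightedSq c (z - w)) := by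
  have h₁ := weightedSq_add_le c (x - y) (y - w)
  have h₂ := weightedSq_add_le c (y - z) (z - w)
  rw [sub_add_sub_cancel] at h₁ h₂
  calc weightedSq c (x - w) ≤ 2 * (weightedSq c (x - y) +
        2 * (weightedSq c (y - z) + weightedSq c (z - w))) := by
        refine h₁.trans ?_
        gcongr
    _ ≤ 2 * (2 * weightedSq c (x - y) +
        2 * (weightedSq c (y - z) + weightedSq c (z - w))) := by
        gcongr
        exact le_mul_of_one_le_left' (by norm_num)
    _ = _ := by ring

theorem weightedSq_le_of_le_add {η : ℝ≥0} (h : ∀ n, c n ≤ η * a n + d n) (v : ℕ → ℂ) :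
    weightedSq c v ≤ η * weightedSq a v + weightedSq d v := by
  unfold weightedSq
  rw [← ENNReal.tsum_mul_left, ← ENNReal.tsum_add]
  gcongr with n
  rw [← mul_assoc, ← add_mul]
  gcongr
  exact_mod_cast h n

theorem weightedSq_const_mul (C : ℝ≥0) (c : ℕ → ℝ≥0) (v : ℕ → ℂ) :
    weightedSq (fun n => C * c n) v = C * weightedSq c v := by
  unfold weightedSq
  rw [← ENNReal.tsum_mul_left]
  simp [mul_assoc]

theorem measurable_weightedSq (c : ℕ → ℝ≥0) {v : ℝ → ℕ → ℂ} (hv : ∀ n, Measurable fun r => v r n) :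
    Measurable fun r => weightedSq c (v r) := by
  unfold weightedSq
  exact Measurable.tsum fun n => ((hv n).enorm.pow_const 2).const_mul _

/-- Fatou's lemma for weighted square sums. -/
theorem weightedSq_le_liminf (c : ℕ → ℝ≥0) {v : ℕ → ℕ → ℂ} {w : ℕ → ℂ}
    (h : ∀ n, Tendsto (fun j => v j n) atTop (𝓝 (w n))) :
    weightedSq c w ≤ liminf (fun j => weightedSq c (v j)) atTop := by
  have hlim : ∀ n, liminf (fun j => (c n : ℝ≥0∞) * ‖v j n‖ₑ ^ 2) atTop = c n * ‖w n‖ₑ ^ 2 :=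
    fun n => (ENNReal.Tendsto.const_mul (ENNReal.Tendsto.pow (h n).enorm)
      (Or.inr ENNReal.coe_ne_top)).liminf_eq
  have := lintegral_liminf_le (μ := Measure.count) (u := atTop)
    (f := fun j n => (c n : ℝ≥0∞) * ‖v j n‖ₑ ^ 2) (fun j => measurable_from_top)
  simpa only [weightedSq, lintegral_count, hlim] using this

theorem weightedSq_le_of_tendsto (c : ℕ → ℝ≥0) {v : ℕ → ℕ → ℂ} {w : ℕ → ℂ} {K : ℝ≥0∞}
    (h : ∀ n, Tendsto (fun j => v j n) atTop (𝓝 (w n))) (hK : ∀ᶠ j in atTop, weightedSq c (v j) ≤ K) :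
    weightedSq c w ≤ K :=
  (weightedSq_le_liminf c h).trans (liminf_le_of_frequently_le' hK.frequently)

/-- The weight `c` cut off at the indices `n ≥ N`. -/
def cutWeight (c : ℕ → ℝ≥0) (N n : ℕ) : ℝ≥0 := if n < N then c n else 0

theorem cutWeight_le (c : ℕ → ℝ≥0) (N : ℕ) : cutWeight c N ≤ c := by
  intro n
  unfold cutWeight
  split_ifs <;> simp

theorem tendsto_weightedSq_cutWeight (c : ℕ → ℝ≥0) (N : ℕ) {v : ℕ → ℕ → ℂ} {w : ℕ → ℂ}
    (h : ∀ n, Tendsto (fun j => v j n) atTop (𝓝 (w n))) :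
    Tendsto (fun j => weightedSq (cutWeight c N) (v j - w)) atTop (𝓝 0) := by
  have hsum : ∀ x : ℕ → ℂ, weightedSq (cutWeight c N) x =
      ∑ n ∈ Finset.range N, (cutWeight c N n : ℝ≥0∞) * ‖x n‖ₑ ^ 2 := fun x =>
    tsum_eq_sum fun n hn => by
      rw [Finset.mem_range] at hn
      simp [cutWeight, hn]
  simp only [hsum]
  rw [show (0 : ℝ≥0∞) = ∑ n ∈ Finset.range N, (cutWeight c N n : ℝ≥0∞) * ‖w n - w n‖ₑ ^ 2 by simp]
  exact tendsto_finsetSum _ fun n _ => ENNReal.Tendsto.const_mul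
    (ENNReal.Tendsto.pow ((h n).sub_const (w n)).enorm) (Or.inr ENNReal.coe_ne_top)

/-- Interpolation: the part of a bounded weight not dominated by a small multiple of an unbounded
weight `a` is supported on finitely many indices. -/
theorem exists_le_mul_add_cutWeight (ha : Tendsto a atTop atTop) {B : ℝ≥0} (hc : ∀ n, c n ≤ B)
    {η : ℝ≥0} (hη : 0 < η) : ∃ N, ∀ n, c n ≤ η * a n + cutWeight c N n := by
  obtain ⟨N, hN⟩ := eventually_atTop.1 (ha.eventually_ge_atTop (B / η))
  refine ⟨N, fun n => ?_⟩
  rcases lt_or_ge n N with h | h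
  · simp [cutWeight, h]
  · have := hN n h
    rw [div_le_iff₀' hη] at this
    exact (hc n).trans (this.trans le_self_add)

/-- Interpolation: the weight `1` is dominated by a small multiple of an unbounded weight `a`
and a large multiple of any positive weight `b`. -/
theorem exists_one_le_mul_add_mul (ha : Tendsto a atTop atTop) (hb : ∀ n, 0 < b n)
    {η : ℝ≥0} (hη : 0 < η) : ∃ C : ℝ≥0, ∀ n, 1 ≤ η * a n + C * b n := by
  obtain ⟨N, hN⟩ := exists_le_mul_add_cutWeight (c := fun _ => 1) ha (fun _ => le_rfl) hη
  refine ⟨∑ n ∈ Finset.range N, (b n)⁻¹, fun n => (hN n).trans (add_le_add le_rfl ?_)⟩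
  unfold cutWeight
  split_ifs with h
  · rw [← div_le_iff₀ (hb n), one_div]
    exact Finset.single_le_sum (f := fun n => (b n)⁻¹) (fun _ _ => zero_le)
      (Finset.mem_range.2 h)
  · exact zero_le

theorem cauchySeq_apply_of_weightedSq {v : ℕ → ℕ → ℂ} (hb : ∀ n, 0 < b n)
    (h : ∀ ε : ℝ≥0, 0 < ε → ∃ J, ∀ j ≥ J, ∀ k ≥ J, weightedSq b (v j - v k) ≤ ε) (n : ℕ) :
    CauchySeq fun j => v j n := by
  refine Metric.cauchySeq_iff.2 fun ε hε => ?_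
  lift ε to ℝ≥0 using hε.le
  have hε' : 0 < ε := hε
  obtain ⟨J, hJ⟩ := h (b n * (ε / 2) ^ 2) (mul_pos (hb n) (by positivity))
  refine ⟨J, fun j hj k hk => ?_⟩
  have h₁ := (le_weightedSq b (v j - v k) n).trans (hJ j hj k hk)
  rw [enorm_eq_nnnorm] at h₁
  have h₂ : b n * ‖(v j - v k) n‖₊ ^ 2 ≤ b n * (ε / 2) ^ 2 := by exact_mod_cast h₁
  have h₃ := le_of_pow_le_pow_left₀ two_ne_zero zero_le (le_of_mul_le_mul_left h₂ (hb n))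
  rw [dist_eq_norm, ← Pi.sub_apply, ← coe_nnnorm]
  exact_mod_cast h₃.trans_lt (NNReal.half_lt_self hε'.ne')

end weightedSq

section AubinLions

variable {a b : ℕ → ℝ≥0} {s t : ℝ} {V : ℕ → ℝ → ℕ → ℂ} {C₁ C₂ B : ℝ≥0}

/-- Diagonal extraction: componentwise convergence along a subsequence at countably many points. -/
theorem exists_subseq_tendsto_of_weightedSq_le (hb : ∀ n, 0 < b n) (x : ℕ → ℕ → ℕ → ℂ)
    (hx : ∀ m i, weightedSq b (x m i) ≤ C₂) :
    ∃ φ : ℕ → ℕ, StrictMono φ ∧ ∃ L : ℕ → ℕ → ℂ,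
      ∀ i n, Tendsto (fun j => x (φ j) i n) atTop (𝓝 (L i n)) := by
  let K : Set (ℕ → ℕ → ℂ) :=
    Set.pi univ fun _ => Set.pi univ fun n => Metric.closedBall 0 (NNReal.sqrt (C₂ / b n))
  have hK : IsCompact K := isCompact_univ_pi fun _ => isCompact_univ_pi fun n =>
    isCompact_closedBall _ _
  have hxK : ∀ m, x m ∈ K := by
    intro m i _ n _
    have h₁ := (le_weightedSq b (x m i) n).trans (hx m i)
    rw [enorm_eq_nnnorm] at h₁
    have h₂ : b n * ‖x m i n‖₊ ^ 2 ≤ C₂ := by exact_mod_cast h₁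
    rw [mem_closedBall_zero_iff, ← coe_nnnorm, NNReal.coe_le_coe, NNReal.le_sqrt_iff_sq_le,
      le_div_iff₀' (hb n)]
    exact h₂
  obtain ⟨L, _, φ, hφ, hL⟩ := hK.tendsto_subseq hxK
  exact ⟨φ, hφ, L, fun i n => (tendsto_pi_nhds.1 (tendsto_pi_nhds.1 hL i) n)⟩

/-- Sequences bounded in `L²(V_a)` have, in every interval, a time at which two given members are
simultaneously controlled. -/
theorem exists_mem_Icc_weightedSq_le (hmeas : ∀ m n, Measurable fun r => V m r n)
    (hint : ∀ m, ∫⁻ r in Icc s t, weightedSq a (V m r) ≤ C₁) {h : ℝ≥0} (hh : 0 < h)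
    (hst : s + h ≤ t) {r : ℝ} (hr : r ∈ Icc s t) (j k : ℕ) :
    ∃ q ∈ Icc s t, |q - r| ≤ h ∧
      weightedSq a (V j q) + weightedSq a (V k q) ≤ ((2 * C₁ / h : ℝ≥0) : ℝ≥0∞) := by
  set x := min r (t - h) with hx
  have hsx : s ≤ x := le_min hr.1 (by linarith)
  have hxt : x + h ≤ t := by linarith [min_le_right r (t - h)]
  have hsub : Icc x (x + h) ⊆ Icc s t := Icc_subset_Icc hsx hxt
  have hvol : volume (Icc x (x + h)) = (h : ℝ≥0∞) := by
    rw [Real.volume_Icc, add_sub_cancel_left, ENNReal.ofReal_coe_nnreal]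
  have hle : ∫⁻ q in Icc x (x + h), (weightedSq a (V j q) + weightedSq a (V k q)) ≤ 2 * C₁ := by
    refine (lintegral_mono_set hsub).trans ?_
    rw [lintegral_add_left (measurable_weightedSq a (hmeas j)), two_mul]
    exact add_le_add (hint j) (hint k)
  obtain ⟨q, hq, hqle⟩ := exists_le_setLAverage (μ := volume) (s := Icc x (x + h))
    (f := fun q => weightedSq a (V j q) + weightedSq a (V k q))
    (by rw [hvol]; exact_mod_cast hh.ne') (by rw [hvol]; exact ENNReal.coe_ne_top)
    (((measurable_weightedSq a (hmeas j)).add (measurable_weightedSq a (hmeas k))).aemeasurable)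
  refine ⟨q, hsub hq, ?_, hqle.trans ?_⟩
  · have h₁ : x ≤ r := min_le_left _ _
    have h₂ : r ≤ x + h := by
      rcases min_choice r (t - h) with h' | h'
      · rw [hx, h']; linarith [h.2]
      · rw [hx, h']; linarith [hr.2]
    rw [abs_le]
    constructor <;> linarith [hq.1, hq.2]
  · rw [setLAverage_eq, hvol, ENNReal.coe_div hh.ne']
    push_cast
    gcongr

theorem exists_subseq_uniformCauchy (ha : Tendsto a atTop atTop) (hb : ∀ n, 0 < b n)
    (hbB : ∀ n, b n ≤ B) (hst : s < t) (hmeas : ∀ m n, Measurable fun r => V m r n)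
    (hint : ∀ m, ∫⁻ r in Icc s t, weightedSq a (V m r) ≤ C₁)
    (hbound : ∀ m, ∀ r ∈ Icc s t, weightedSq b (V m r) ≤ C₂)
    (hequi : ∀ ε : ℝ≥0, 0 < ε → ∃ h : ℝ≥0, 0 < h ∧ ∀ m, ∀ p ∈ Icc s t, ∀ q ∈ Icc s t,
      |q - p| ≤ h → weightedSq b (V m q - V m p) ≤ ε) :
    ∃ φ : ℕ → ℕ, StrictMono φ ∧ ∀ ε : ℝ≥0, 0 < ε → ∃ J, ∀ j ≥ J, ∀ k ≥ J, ∀ r ∈ Icc s t,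
      weightedSq b (V (φ j) r - V (φ k) r) ≤ ε := by
  have : Nonempty (Icc s t) := ⟨⟨s, left_mem_Icc.2 hst.le⟩⟩
  let g : ℕ → Icc s t := TopologicalSpace.denseSeq (Icc s t)
  obtain ⟨φ, hφ, L, hL⟩ := exists_subseq_tendsto_of_weightedSq_le hb (fun m i => V m (g i))
    fun m i => hbound m _ (g i).2
  refine ⟨φ, hφ, fun ε hε => ?_⟩
  set δ : ℝ≥0 := ε / 108 with hδ
  have hδ0 : 0 < δ := by positivity
  obtain ⟨h₀, hh₀, hmod⟩ := hequi δ hδ0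
  obtain ⟨h, hh, hhh₀, hhst⟩ : ∃ h : ℝ≥0, 0 < h ∧ 2 * h ≤ h₀ ∧ s + h ≤ t := by
    refine ⟨min (h₀ / 2) (t - s).toNNReal, lt_min (by positivity) (by simpa using hst), ?_, ?_⟩
    · calc 2 * min (h₀ / 2) (t - s).toNNReal ≤ 2 * (h₀ / 2) := by gcongr; exact min_le_left _ _
        _ = h₀ := by ring
    · have : ((min (h₀ / 2) (t - s).toNNReal : ℝ≥0) : ℝ) ≤ t - s := by
        refine (NNReal.coe_le_coe.2 (min_le_right _ _)).trans_eq ?_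
        exact Real.coe_toNNReal (t - s) (by linarith)
      linarith
  have hhh₀' : 2 * (h : ℝ) ≤ h₀ := by exact_mod_cast hhh₀
  set K : ℝ≥0 := 2 * (2 * C₁ / h) with hK
  obtain ⟨N, hN⟩ := exists_le_mul_add_cutWeight (η := δ / (K + 1)) ha hbB (by positivity)
  obtain ⟨I, hI⟩ : ∃ I : Finset ℕ, univ ⊆ ⋃ i ∈ I, Metric.ball (g i) h := by
    refine isCompact_univ.elim_finite_subcover _ (fun i => Metric.isOpen_ball) fun r _ => ?_
    obtain ⟨i, hi⟩ := (TopologicalSpace.denseRange_denseSeq (Icc s t)).exists_dist_lt r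
      (NNReal.coe_pos.2 hh)
    exact mem_iUnion.2 ⟨i, hi⟩
  have hgrid : ∀ᶠ j in atTop, ∀ i ∈ I,
      weightedSq (cutWeight b N) (V (φ j) (g i) - L i) ≤ δ := by
    refine (Filter.eventually_all_finset I).2 fun i _ => ?_
    exact ENNReal.tendsto_nhds_zero.1 (tendsto_weightedSq_cutWeight b N (hL i)) δ
      (by exact_mod_cast hδ0)
  obtain ⟨J, hJ⟩ := eventually_atTop.1 hgrid
  refine ⟨J, fun j hj k hk r hr => ?_⟩
  obtain ⟨q, hq, hqr, hqa⟩ := exists_mem_Icc_weightedSq_le hmeas hint hh hhst hr (φ j) (φ k)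
  obtain ⟨i, hi, hir⟩ : ∃ i ∈ I, |r - g i| < h := by
    have := hI (mem_univ ⟨r, hr⟩)
    simpa [Subtype.dist_eq, Real.dist_eq] using this
  have hqi : |q - g i| ≤ h₀ := by
    have := abs_sub_le q r (g i)
    linarith
  have hqr₀ : |q - r| ≤ h₀ := by linarith [h.2]
  have hmid : weightedSq (cutWeight b N) (V (φ j) (g i) - V (φ k) (g i)) ≤ 2 * (δ + δ) := by
    have := weightedSq_sub_le (cutWeight b N) (V (φ j) (g i) - L i) (V (φ k) (g i) - L i)
    rw [sub_sub_sub_cancel_right] at this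
    refine this.trans ?_
    gcongr
    · exact hJ j hj i hi
    · exact hJ k hk i hi
  have hlow : weightedSq (cutWeight b N) (V (φ j) q - V (φ k) q) ≤ 4 * (δ + 2 * (δ + δ) + δ) := by
    refine (weightedSq_sub_le_three _ _ (V (φ j) (g i)) (V (φ k) (g i)) _).trans ?_
    gcongr
    · exact (weightedSq_mono (cutWeight_le b N) _).trans (hmod _ _ (g i).2 _ hq hqi)
    · rw [weightedSq_sub_comm]
      exact (weightedSq_mono (cutWeight_le b N) _).trans (hmod _ _ (g i).2 _ hq hqi)
  have hhigh : weightedSq a (V (φ j) q - V (φ k) q) ≤ K := by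
    refine (weightedSq_sub_le _ _ _).trans ?_
    rw [hK, ENNReal.coe_mul]
    gcongr
    norm_num
  have hη : δ / (K + 1) * K ≤ δ := by
    rw [div_mul_eq_mul_div, div_le_iff₀ (by positivity)]
    gcongr
    exact le_self_add
  have hatq : weightedSq b (V (φ j) q - V (φ k) q) ≤ δ + 4 * (δ + 2 * (δ + δ) + δ) := by
    refine (weightedSq_le_of_le_add hN _).trans (add_le_add ?_ hlow)
    calc _ ≤ ((δ / (K + 1) : ℝ≥0) : ℝ≥0∞) * K := by gcongr
      _ ≤ δ := by exact_mod_cast hη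
  calc weightedSq b (V (φ j) r - V (φ k) r)
      ≤ 4 * (weightedSq b (V (φ j) r - V (φ j) q) + weightedSq b (V (φ j) q - V (φ k) q)
        + weightedSq b (V (φ k) q - V (φ k) r)) := weightedSq_sub_le_three _ _ _ _ _
    _ ≤ 4 * (δ + (δ + 4 * (δ + 2 * (δ + δ) + δ)) + δ) := by
        gcongr
        · rw [weightedSq_sub_comm]
          exact hmod _ _ hr _ hq hqr₀
        · exact hmod _ _ hr _ hq hqr₀
    _ = ((4 * (δ + (δ + 4 * (δ + 2 * (δ + δ) + δ)) + δ) : ℝ≥0) : ℝ≥0∞) := by push_cast; rfl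
    _ = ε := by
        congr 1
        rw [hδ]
        apply NNReal.eq
        push_cast
        ring

theorem lintegral_weightedSq_one_le {η C : ℝ≥0} (h : ∀ n, 1 ≤ η * a n + C * b n)
    {v : ℝ → ℕ → ℂ} (hv : ∀ n, Measurable fun r => v r n) {K D : ℝ≥0∞}
    (hK : ∫⁻ r in Icc s t, weightedSq a (v r) ≤ K) (hD : ∀ r ∈ Icc s t, weightedSq b (v r) ≤ D) :
    ∫⁻ r in Icc s t, weightedSq (fun _ => 1) (v r) ≤
      η * K + C * (D * ENNReal.ofReal (t - s)) := by
  have hD' : ∫⁻ r in Icc s t, weightedSq b (v r) ≤ D * ENNReal.ofReal (t - s) := by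
    rw [← Real.volume_Icc, ← setLIntegral_const]
    exact setLIntegral_mono measurable_const hD
  calc _ ≤ ∫⁻ r in Icc s t, (η * weightedSq a (v r) + C * weightedSq b (v r)) := by
        refine lintegral_mono fun r => ?_
        rw [← weightedSq_const_mul C b]
        exact weightedSq_le_of_le_add h (v r)
    _ = η * (∫⁻ r in Icc s t, weightedSq a (v r)) + C * ∫⁻ r in Icc s t, weightedSq b (v r) := by
        rw [lintegral_add_left ((measurable_weightedSq a hv).const_mul _),
          lintegral_const_mul _ (measurable_weightedSq a hv),
          lintegral_const_mul _ (measurable_weightedSq b hv)]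
    _ ≤ _ := by gcongr

/-- The Aubin–Lions compactness theorem for weighted sequence spaces: boundedness in `L²` with
respect to an unbounded weight `a` and equicontinuity with respect to a bounded weight `b` yield
compactness in `L²(ℓ²)` and, uniformly in time, with respect to the weight `b`. -/
theorem aubinLions_weightedSq (ha : Tendsto a atTop atTop) (hb : ∀ n, 0 < b n)
    (hbB : ∀ n, b n ≤ B) (hst : s < t) (hmeas : ∀ m n, Measurable fun r => V m r n)
    (hzero : ∀ m, ∀ r ∉ Icc s t, V m r = 0)
    (hint : ∀ m, ∫⁻ r in Icc s t, weightedSq a (V m r) ≤ C₁)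
    (hbound : ∀ m, ∀ r ∈ Icc s t, weightedSq b (V m r) ≤ C₂)
    (hequi : ∀ ε : ℝ≥0, 0 < ε → ∃ h : ℝ≥0, 0 < h ∧ ∀ m, ∀ p ∈ Icc s t, ∀ q ∈ Icc s t,
      |q - p| ≤ h → weightedSq b (V m q - V m p) ≤ ε) :
    ∃ φ : ℕ → ℕ, StrictMono φ ∧ ∃ w : ℝ → ℕ → ℂ,
      (∀ n, Measurable fun r => w r n) ∧
      (∀ r ∈ Icc s t, weightedSq b (w r) ≤ C₂) ∧
      (∫⁻ r in Icc s t, weightedSq (fun _ => 1) (w r) ≠ ⊤) ∧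
      (∀ ε : ℝ≥0, 0 < ε → ∃ h : ℝ≥0, 0 < h ∧ ∀ p ∈ Icc s t, ∀ q ∈ Icc s t,
        |q - p| ≤ h → weightedSq b (w q - w p) ≤ ε) ∧
      (∀ j, ∫⁻ r in Icc s t, weightedSq (fun _ => 1) (V (φ j) r - w r) ≠ ⊤) ∧
      Tendsto (fun j => ∫⁻ r in Icc s t, weightedSq (fun _ => 1) (V (φ j) r - w r)) atTop (𝓝 0) ∧
      (∀ ε : ℝ≥0, 0 < ε → ∃ J, ∀ j ≥ J, ∀ r ∈ Icc s t,
        weightedSq b (V (φ j) r - w r) ≤ ε) := by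
  obtain ⟨φ, hφ, hC⟩ := exists_subseq_uniformCauchy ha hb hbB hst hmeas hint hbound hequi
  have hlim : ∀ r n, ∃ z, Tendsto (fun j => V (φ j) r n) atTop (𝓝 z) := by
    intro r n
    by_cases hr : r ∈ Icc s t
    · refine cauchySeq_tendsto_of_complete
        (cauchySeq_apply_of_weightedSq (v := fun j => V (φ j) r) hb (fun ε hε => ?_) n)
      obtain ⟨J, hJ⟩ := hC ε hε
      exact ⟨J, fun j hj k hk => hJ j hj k hk r hr⟩
    · exact ⟨0, by simp [hzero _ r hr]⟩
  choose w hw using hlim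
  have hwmeas : ∀ n, Measurable fun r => w r n := fun n =>
    measurable_of_tendsto_metrizable (fun j => hmeas (φ j) n) (tendsto_pi_nhds.2 fun r => hw r n)
  have hwb : ∀ r ∈ Icc s t, weightedSq b (w r) ≤ C₂ := fun r hr =>
    weightedSq_le_of_tendsto b (hw r) (Eventually.of_forall fun j => hbound (φ j) r hr)
  have hwa : ∫⁻ r in Icc s t, weightedSq a (w r) ≤ C₁ :=
    calc _ ≤ ∫⁻ r in Icc s t, liminf (fun j => weightedSq a (V (φ j) r)) atTop :=
          lintegral_mono fun r => weightedSq_le_liminf a (hw r)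
      _ ≤ liminf (fun j => ∫⁻ r in Icc s t, weightedSq a (V (φ j) r)) atTop :=
          lintegral_liminf_le fun j => measurable_weightedSq a (hmeas (φ j))
      _ ≤ C₁ := liminf_le_of_frequently_le' (Frequently.of_forall fun j => hint (φ j))
  have hunif : ∀ ε : ℝ≥0, 0 < ε → ∃ J, ∀ j ≥ J, ∀ r ∈ Icc s t,
      weightedSq b (V (φ j) r - w r) ≤ ε := by
    intro ε hε
    obtain ⟨J, hJ⟩ := hC ε hε
    refine ⟨J, fun j hj r hr => ?_⟩
    refine weightedSq_le_of_tendsto b (v := fun k => V (φ j) r - V (φ k) r)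
      (fun n => (hw r n).const_sub _) ?_
    exact eventually_atTop.2 ⟨J, fun k hk => hJ j hj k hk r hr⟩
  have hdmeas : ∀ j n, Measurable fun r => (V (φ j) r - w r) n := fun j n =>
    (hmeas (φ j) n).sub (hwmeas n)
  have hda : ∀ j, ∫⁻ r in Icc s t, weightedSq a (V (φ j) r - w r) ≤
      ((2 * (C₁ + C₁) : ℝ≥0) : ℝ≥0∞) := by
    intro j
    calc _ ≤ ∫⁻ r in Icc s t, 2 * (weightedSq a (V (φ j) r) + weightedSq a (w r)) :=
          lintegral_mono fun r => weightedSq_sub_le _ _ _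
      _ = 2 * ((∫⁻ r in Icc s t, weightedSq a (V (φ j) r))
            + ∫⁻ r in Icc s t, weightedSq a (w r)) := by
          rw [lintegral_const_mul' _ _ (by norm_num),
            lintegral_add_left (measurable_weightedSq a (hmeas _))]
      _ ≤ 2 * (C₁ + C₁) := by
          gcongr
          exact hint _
      _ = _ := by push_cast; rfl
  obtain ⟨C, hC1⟩ := exists_one_le_mul_add_mul ha hb one_pos
  refine ⟨φ, hφ, w, hwmeas, hwb, ?_, ?_, ?_, ?_, hunif⟩
  · refine ne_top_of_le_ne_top ?_ (lintegral_weightedSq_one_le hC1 hwmeas hwa hwb)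
    finiteness
  · intro ε hε
    obtain ⟨h, hh, hmod⟩ := hequi ε hε
    refine ⟨h, hh, fun p hp q hq hpq => ?_⟩
    exact weightedSq_le_of_tendsto b (v := fun k => V (φ k) q - V (φ k) p)
      (fun n => (hw q n).sub (hw p n)) (Eventually.of_forall fun k => hmod _ p hp q hq hpq)
  · intro j
    refine ne_top_of_le_ne_top ?_ (lintegral_weightedSq_one_le hC1 (hdmeas j) (hda j)
      (D := 2 * (C₂ + C₂)) fun r hr => (weightedSq_sub_le _ _ _).trans ?_)
    · finiteness
    · gcongr
      · exact hbound _ r hr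
      · exact hwb r hr
  · refine ENNReal.tendsto_nhds_zero.2 fun ε hε => ?_
    obtain ⟨δ, hδ0, hδε⟩ := ENNReal.lt_iff_exists_nnreal_btwn.1 hε
    have hδ : 0 < δ := by exact_mod_cast hδ0
    set K : ℝ≥0 := 2 * (C₁ + C₁)
    obtain ⟨D, hD⟩ := exists_one_le_mul_add_mul (η := δ / 2 / (K + 1)) ha hb (by positivity)
    set M : ℝ≥0 := D * (t - s).toNNReal
    obtain ⟨J, hJ⟩ := hunif (δ / 2 / (M + 1)) (by positivity)
    have hsmall : ∀ x y : ℝ≥0, x / (y + 1) * y ≤ x := fun x y => by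
      rw [div_mul_eq_mul_div, div_le_iff₀ (by positivity)]
      gcongr
      exact le_self_add
    have hsum : δ / 2 / (K + 1) * K + D * (δ / 2 / (M + 1) * (t - s).toNNReal) ≤ δ := by
      calc _ = δ / 2 / (K + 1) * K + δ / 2 / (M + 1) * M := by ring
        _ ≤ δ / 2 + δ / 2 := add_le_add (hsmall _ _) (hsmall _ _)
        _ = δ := add_halves δ
    filter_upwards [eventually_ge_atTop J] with j hj
    refine (lintegral_weightedSq_one_le hD (hdmeas j) (hda j) (hJ j hj)).trans (le_trans ?_ hδε.le)
    rw [ENNReal.ofReal]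
    exact_mod_cast hsum

end AubinLions

section Bridge

theorem weightedSq_eq_tsum_coe (c : ℕ → ℝ≥0) (v : ℕ → ℂ) :
    weightedSq c v = ∑' n, ((c n * ‖v n‖₊ ^ 2 : ℝ≥0) : ℝ≥0∞) := by
  simp [weightedSq, enorm_eq_nnnorm]

theorem toReal_weightedSq (c : ℕ → ℝ≥0) (v : ℕ → ℂ) :
    (weightedSq c v).toReal = ∑' n, (c n : ℝ) * ‖v n‖ ^ 2 := by
  rw [weightedSq_eq_tsum_coe, ENNReal.tsum_toReal_eq fun _ => ENNReal.coe_ne_top]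
  simp

theorem weightedSq_ne_top_iff {c : ℕ → ℝ≥0} {v : ℕ → ℂ} :
    weightedSq c v ≠ ⊤ ↔ Summable fun n => (c n : ℝ) * ‖v n‖ ^ 2 := by
  rw [weightedSq_eq_tsum_coe, ENNReal.tsum_coe_ne_top_iff_summable, ← NNReal.summable_coe]
  simp

theorem toReal_weightedSq_one (v : ℕ → ℂ) :
    (weightedSq (fun _ => 1) v).toReal = ∑' n, ‖v n‖ ^ 2 := by
  simp [toReal_weightedSq]

variable {k0 lam : ℝ}

theorem kk_pos (hk0 : 0 < k0) (hlam : 1 < lam) (n : ℕ) : 0 < kk k0 lam n := by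
  unfold kk
  positivity

theorem le_kk (hk0 : 0 < k0) (hlam : 1 < lam) (n : ℕ) : k0 ≤ kk k0 lam n :=
  le_mul_of_one_le_right hk0.le (one_le_pow₀ hlam.le)

/-- The weight `k_{n+1}^{4e}` of the space `V_e`. -/
noncomputable def vWeight (k0 lam e : ℝ) (n : ℕ) : ℝ≥0 := (kk k0 lam (n + 1) ^ (4 * e)).toNNReal

theorem coe_vWeight (hk0 : 0 < k0) (hlam : 1 < lam) (e : ℝ) (n : ℕ) :
    (vWeight k0 lam e n : ℝ) = kk k0 lam (n + 1) ^ (4 * e) :=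
  Real.coe_toNNReal _ (Real.rpow_nonneg (kk_pos hk0 hlam _).le _)

theorem vWeight_pos (hk0 : 0 < k0) (hlam : 1 < lam) (e : ℝ) (n : ℕ) : 0 < vWeight k0 lam e n :=
  Real.toNNReal_pos.2 (Real.rpow_pos_of_pos (kk_pos hk0 hlam _) _)

theorem tendsto_vWeight_atTop (hk0 : 0 < k0) (hlam : 1 < lam) {e : ℝ} (he : 0 < e) :
    Tendsto (vWeight k0 lam e) atTop atTop := by
  refine Real.tendsto_toNNReal_atTop.comp
    ((tendsto_rpow_atTop (mul_pos four_pos he)).comp ?_)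
  exact (tendsto_add_atTop_iff_nat 1).2
    ((tendsto_pow_atTop_atTop_of_one_lt hlam).const_mul_atTop hk0)

theorem vWeight_le_of_nonpos (hk0 : 0 < k0) (hlam : 1 < lam) {e : ℝ} (he : e ≤ 0) (n : ℕ) :
    vWeight k0 lam e n ≤ (k0 ^ (4 * e)).toNNReal :=
  Real.toNNReal_le_toNNReal
    (Real.rpow_le_rpow_of_nonpos hk0 (le_kk hk0 hlam _) (by linarith))

theorem vWeight_add (hk0 : 0 < k0) (hlam : 1 < lam) (e f : ℝ) (n : ℕ) :
    vWeight k0 lam (e + f) n = vWeight k0 lam e n * vWeight k0 lam f n := by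
  apply NNReal.eq
  rw [NNReal.coe_mul, coe_vWeight hk0 hlam, coe_vWeight hk0 hlam, coe_vWeight hk0 hlam, mul_add,
    Real.rpow_add (kk_pos hk0 hlam _)]

theorem memV_iff (hk0 : 0 < k0) (hlam : 1 < lam) {e : ℝ} {u : ℕ → ℂ} :
    memV k0 lam e u ↔ weightedSq (vWeight k0 lam e) (fun n => u (n + 1)) ≠ ⊤ := by
  rw [weightedSq_ne_top_iff]
  simp only [coe_vWeight hk0 hlam, memV]

theorem normV_eq (hk0 : 0 < k0) (hlam : 1 < lam) (e : ℝ) (u : ℕ → ℂ) :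
    normV k0 lam e u =
      √(weightedSq (vWeight k0 lam e) (fun n => u (n + 1))).toReal := by
  rw [toReal_weightedSq]
  simp only [coe_vWeight hk0 hlam, normV]

theorem memV.anti (hk0 : 0 < k0) (hlam : 1 < lam) {e f : ℝ} (hef : e ≤ f) {u : ℕ → ℂ}
    (hu : memV k0 lam f u) : memV k0 lam e u := by
  rw [memV_iff hk0 hlam] at hu ⊢
  have hle : vWeight k0 lam e ≤
      fun n => (k0 ^ (4 * (e - f))).toNNReal * vWeight k0 lam f n := fun n => by
    calc vWeight k0 lam e n = vWeight k0 lam (e - f) n * vWeight k0 lam f n := by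
          rw [← vWeight_add hk0 hlam, sub_add_cancel]
      _ ≤ _ := mul_le_mul_left (vWeight_le_of_nonpos hk0 hlam (by linarith) n) _
  refine ne_top_of_le_ne_top ?_ (weightedSq_mono hle _)
  rw [weightedSq_const_mul]
  finiteness

theorem memV.sub (hk0 : 0 < k0) (hlam : 1 < lam) {e : ℝ} {u v : ℕ → ℂ}
    (hu : memV k0 lam e u) (hv : memV k0 lam e v) : memV k0 lam e fun n => u n - v n := by
  rw [memV_iff hk0 hlam] at *
  exact ne_top_of_le_ne_top (by finiteness) (weightedSq_sub_le _ _ _)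

theorem weightedSq_le_of_normV_le (hk0 : 0 < k0) (hlam : 1 < lam) {e C : ℝ} {u : ℕ → ℂ}
    (hu : memV k0 lam e u) (h : normV k0 lam e u ≤ C) :
    weightedSq (vWeight k0 lam e) (fun n => u (n + 1)) ≤ (C ^ 2).toNNReal := by
  rw [normV_eq hk0 hlam, Real.sqrt_le_iff] at h
  rw [memV_iff hk0 hlam] at hu
  exact (ENNReal.le_ofReal_iff_toReal_le hu (sq_nonneg C)).2 h.2

theorem normV_le_of_weightedSq_le (hk0 : 0 < k0) (hlam : 1 < lam) {e ε : ℝ} (hε : 0 ≤ ε)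
    {u : ℕ → ℂ} (h : weightedSq (vWeight k0 lam e) (fun n => u (n + 1)) ≤ (ε ^ 2).toNNReal) :
    normV k0 lam e u ≤ ε := by
  rw [normV_eq hk0 hlam, Real.sqrt_le_iff]
  exact ⟨hε, ENNReal.toReal_le_of_le_ofReal (sq_nonneg ε) h⟩

end Bridge

/-- Theorem 2.2 (i): Aubin–Lions type compactness.  A sequence `(u_m)` of strongly measurable
functions `[s,t] → V_α` (componentwise measurable), bounded in `L²(s,t;V_α)` and bounded in
`C^β([s,t];V_{-δ})`, has a subsequence converging to some
`u ∈ L²(s,t;V) ∩ C([s,t];V_{-δ})` strongly in `L²(s,t;V)` and uniformly in `V_{-δ}`. -/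
theorem stmt8 (k0 lam : ℝ) (hk0 : 0 < k0) (hlam : 1 < lam)
    (α δ β s t : ℝ) (hα : 0 < α) (hδ : 0 < δ) (hβ0 : 0 < β) (hβ1 : β ≤ 1) (hst : s < t)
    (U : ℕ → ℝ → ℕ → ℂ) (C₁ C₂ : ℝ)
    (hmeas : ∀ m n : ℕ, Measurable (fun r : ℝ => U m r n))
    (hmem : ∀ m : ℕ, ∀ r ∈ Icc s t, memV k0 lam α (U m r))
    (hL2int : ∀ m : ℕ, IntegrableOn
      (fun r : ℝ => ∑' n : ℕ, (kk k0 lam (n+1)) ^ (4*α) * ‖U m r (n+1)‖^2) (Icc s t))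
    (hL2bdd : ∀ m : ℕ,
      (∫ r in Icc s t, ∑' n : ℕ, (kk k0 lam (n+1)) ^ (4*α) * ‖U m r (n+1)‖^2) ≤ C₁)
    (hbound : ∀ m : ℕ, ∀ r ∈ Icc s t, normV k0 lam (-δ) (U m r) ≤ C₂)
    (hHold : ∀ m : ℕ, ∀ p q : ℝ, s ≤ p → p < q → q ≤ t →
      normV k0 lam (-δ) (fun n => U m q n - U m p n) ≤ C₂ * (q - p) ^ β) :
    ∃ φ : ℕ → ℕ, StrictMono φ ∧ ∃ w : ℝ → ℕ → ℂ,
      (∀ r ∈ Icc s t, memV k0 lam (-δ) (w r)) ∧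
      IntegrableOn (fun r : ℝ => ∑' n : ℕ, ‖w r (n+1)‖^2) (Icc s t) ∧
      (∀ r₀ ∈ Icc s t, ∀ ε : ℝ, 0 < ε → ∃ η : ℝ, 0 < η ∧ ∀ r ∈ Icc s t, |r - r₀| < η →
        normV k0 lam (-δ) (fun n => w r n - w r₀ n) ≤ ε) ∧
      (∀ j : ℕ, IntegrableOn
        (fun r : ℝ => ∑' n : ℕ, ‖U (φ j) r (n+1) - w r (n+1)‖^2) (Icc s t)) ∧
      Tendsto (fun j : ℕ => ∫ r in Icc s t, ∑' n : ℕ, ‖U (φ j) r (n+1) - w r (n+1)‖^2)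
        atTop (nhds 0) ∧
      (∀ ε : ℝ, 0 < ε → ∃ N : ℕ, ∀ j ≥ N, ∀ r ∈ Icc s t,
        normV k0 lam (-δ) (fun n => U (φ j) r n - w r n) ≤ ε) := by
  set a := vWeight k0 lam α with ha
  set b := vWeight k0 lam (-δ) with hb
  have hmem' : ∀ m, ∀ r ∈ Icc s t, memV k0 lam (-δ) (U m r) := fun m r hr =>
    (hmem m r hr).anti hk0 hlam (by linarith)
  let V : ℕ → ℝ → ℕ → ℂ := fun m r => if r ∈ Icc s t then fun n => U m r (n + 1) else 0
  have hV : ∀ m, ∀ r ∈ Icc s t, V m r = fun n => U m r (n + 1) := fun m r hr => if_pos hr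
  have hVmeas : ∀ m n, Measurable fun r => V m r n := by
    intro m n
    have : (fun r => V m r n) = (Icc s t).indicator fun r => U m r (n + 1) := by
      ext r
      by_cases hr : r ∈ Icc s t <;> simp only [V, hr, indicator, if_true, if_false, Pi.zero_apply]
    rw [this]
    exact (hmeas m (n + 1)).indicator measurableSet_Icc
  have hVint : ∀ m, ∫⁻ r in Icc s t, weightedSq a (V m r) ≤ C₁.toNNReal := by
    intro m
    have hreal : ∀ r, ∑' n : ℕ, kk k0 lam (n + 1) ^ (4 * α) * ‖U m r (n + 1)‖ ^ 2 =
        (weightedSq a fun n => U m r (n + 1)).toReal := fun r => by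
      rw [toReal_weightedSq]
      simp only [ha, coe_vWeight hk0 hlam]
    have hint := hL2int m
    have hbdd := hL2bdd m
    simp only [hreal] at hint hbdd
    calc _ = ∫⁻ r in Icc s t, ENNReal.ofReal (weightedSq a fun n => U m r (n + 1)).toReal := by
          refine setLIntegral_congr_fun measurableSet_Icc fun r hr => ?_
          simp only [hV m r hr]
          rw [ENNReal.ofReal_toReal ((memV_iff hk0 hlam).1 (hmem m r hr))]
      _ = ENNReal.ofReal (∫ r in Icc s t, (weightedSq a fun n => U m r (n + 1)).toReal) :=
          (ofReal_integral_eq_lintegral_ofReal hint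
            (Eventually.of_forall fun _ => ENNReal.toReal_nonneg)).symm
      _ ≤ _ := ENNReal.ofReal_le_ofReal hbdd
  have hVbound : ∀ m, ∀ r ∈ Icc s t, weightedSq b (V m r) ≤ (C₂ ^ 2).toNNReal := by
    intro m r hr
    rw [hV m r hr]
    exact weightedSq_le_of_normV_le hk0 hlam (hmem' m r hr) (hbound m r hr)
  have hVequi : ∀ ε : ℝ≥0, 0 < ε → ∃ h : ℝ≥0, 0 < h ∧ ∀ m, ∀ p ∈ Icc s t, ∀ q ∈ Icc s t,
      |q - p| ≤ h → weightedSq b (V m q - V m p) ≤ ε := by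
    intro ε hε
    have hcont : Continuous fun x : ℝ => (C₂ * x ^ β) ^ 2 :=
      ((Real.continuous_rpow_const hβ0.le).const_mul C₂).pow 2
    have hlim : Tendsto (fun x : ℝ => (C₂ * x ^ β) ^ 2) (𝓝 0) (𝓝 0) := by
      simpa [Real.zero_rpow hβ0.ne'] using hcont.tendsto 0
    obtain ⟨η, hη, hηε⟩ := Metric.eventually_nhds_iff.1
      (hlim.eventually_le_const (NNReal.coe_pos.2 hε))
    have hlt : ∀ m, ∀ p ∈ Icc s t, ∀ q ∈ Icc s t, p < q → q - p < η →
        weightedSq b (V m q - V m p) ≤ ε := by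
      intro m p hp q hq hpq hqp
      rw [hV m p hp, hV m q hq]
      refine (weightedSq_le_of_normV_le hk0 hlam ((hmem' m q hq).sub hk0 hlam (hmem' m p hp))
        (hHold m p q hp.1 hpq hq.2)).trans ?_
      rw [ENNReal.coe_le_coe]
      refine Real.toNNReal_le_iff_le_coe.2 (hηε ?_)
      rwa [Real.dist_eq, sub_zero, abs_of_pos (sub_pos.2 hpq)]
    refine ⟨(η / 2).toNNReal, Real.toNNReal_pos.2 (half_pos hη), fun m p hp q hq hpq => ?_⟩
    rw [Real.coe_toNNReal _ (half_pos hη).le] at hpq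
    have hpq' := abs_le.1 hpq
    rcases lt_trichotomy p q with h | h | h
    · exact hlt m p hp q hq h (by linarith)
    · rw [h, sub_self, weightedSq_zero]
      exact zero_le
    · rw [weightedSq_sub_comm]
      exact hlt m q hq p hp h (by linarith)
  obtain ⟨φ, hφ, w, hwmeas, hwb, hw2, hwc, hd2, hdlim, hunif⟩ := aubinLions_weightedSq
    (tendsto_vWeight_atTop hk0 hlam hα) (vWeight_pos hk0 hlam (-δ))
    (vWeight_le_of_nonpos hk0 hlam (neg_nonpos.2 hδ.le)) hst hVmeas
    (fun m r hr => if_neg hr) hVint hVbound hVequi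
  have hdmeas : ∀ j, Measurable fun r => weightedSq (fun _ => 1) (V (φ j) r - w r) := fun j =>
    measurable_weightedSq _ fun n => (hVmeas (φ j) n).sub (hwmeas n)
  have hdreal : ∀ j, EqOn (fun r => (weightedSq (fun _ => 1) (V (φ j) r - w r)).toReal)
      (fun r => ∑' n : ℕ, ‖U (φ j) r (n + 1) - w r n‖ ^ 2) (Icc s t) := fun j r hr => by
    simp only [toReal_weightedSq_one, hV _ r hr, Pi.sub_apply]
  refine ⟨φ, hφ, fun r n => w r (n - 1), ?_, ?_, ?_, ?_, ?_, ?_⟩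
  · exact fun r hr => (memV_iff hk0 hlam).2 (ne_top_of_le_ne_top ENNReal.coe_ne_top (hwb r hr))
  · simp only [Nat.add_sub_cancel, ← toReal_weightedSq_one]
    exact integrable_toReal_of_lintegral_ne_top (measurable_weightedSq _ hwmeas).aemeasurable hw2
  · intro r₀ hr₀ ε hε
    obtain ⟨h, hh, hmod⟩ := hwc (ε ^ 2).toNNReal (Real.toNNReal_pos.2 (by positivity))
    exact ⟨h, hh, fun r hr hrr₀ =>
      normV_le_of_weightedSq_le hk0 hlam hε.le (hmod r₀ hr₀ r hr hrr₀.le)⟩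
  · exact fun j => IntegrableOn.congr_fun (integrable_toReal_of_lintegral_ne_top
      (hdmeas j).aemeasurable (hd2 j)) (hdreal j) measurableSet_Icc
  · have hint : ∀ j, ∫ r in Icc s t, ∑' n : ℕ, ‖U (φ j) r (n + 1) - w r n‖ ^ 2 =
        (∫⁻ r in Icc s t, weightedSq (fun _ => 1) (V (φ j) r - w r)).toReal := fun j => by
      rw [← setIntegral_congr_fun measurableSet_Icc (hdreal j)]
      exact integral_toReal (hdmeas j).aemeasurable (ae_lt_top (hdmeas j) (hd2 j))
    simp only [Nat.add_sub_cancel, hint]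
    exact (ENNReal.tendsto_toReal ENNReal.zero_ne_top).comp hdlim
  · intro ε hε
    obtain ⟨J, hJ⟩ := hunif (ε ^ 2).toNNReal (Real.toNNReal_pos.2 (by positivity))
    refine ⟨J, fun j hj r hr => normV_le_of_weightedSq_le hk0 hlam hε.le ?_⟩
    have := hJ j hj r hr
    rwa [hV _ r hr] at this
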